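/- Let n, m, p be positive natural numbers. Let A ∈ ℝ^{n×n}, B ∈ ℝ^{n×m}, C ∈ ℝ^{p×n}, let O = [C; CA; …; CA^{n−1}] ∈ ℝ^{np×n}, and assume there exists L ∈ ℝ^{n×np} with L O = I_n. Define F₁ ∈ ℝ^{np×nm} as the block matrix whose (i,j) block (0 ≤ i,j ≤ n−1) equals C A^{i−1−j} B if j ≤ i−1 and zero otherwise, and F₂ = [C A^{n−1} B, C A^{n−2} B, …, C B] ∈ ℝ^{p×nm}. Set 𝒜_y = C A^n L ∈ ℝ^{p×np} and 𝒜_u = F₂ − C A^n L F₁ ∈ ℝ^{p×nm}. Let u : ℕ → ℝ^m be an input and x : ℕ → ℝ^n, y : ℕ → ℝ^p a trajectory with x(t+1) = A x(t) + B u(t) and y(t) = C x(t) for all t. Then for every t ≥ n, y(t) = 𝒜_u U(t−1) + 𝒜_y Y(t−1), where U(t−1) = [u(t−n); …; u(t−1)] and Y(t−1) = [y(t−n); …; y(t−1)]. -/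

import Mathlib

open Matrix

/-- The observability matrix `O = [C; CA; …; CA^{n−1}]`, with rows indexed by
`Fin n × Fin p` (block `i` is `C Aⁱ`). -/
def obsMat {n p : ℕ} (A : Matrix (Fin n) (Fin n) ℝ) (C : Matrix (Fin p) (Fin n) ℝ) :
    Matrix (Fin n × Fin p) (Fin n) ℝ :=
  Matrix.of fun ia j => (C * A ^ (ia.1 : ℕ)) ia.2 j

/-- The block Toeplitz matrix `F₁` with `(i,j)` block equal to `C A^{i−1−j} B` when
`j ≤ i−1` (i.e. `j < i`) and `0` otherwise, `0 ≤ i, j ≤ n−1`. -/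
def f1Mat {n m p : ℕ} (A : Matrix (Fin n) (Fin n) ℝ) (B : Matrix (Fin n) (Fin m) ℝ)
    (C : Matrix (Fin p) (Fin n) ℝ) :
    Matrix (Fin n × Fin p) (Fin n × Fin m) ℝ :=
  Matrix.of fun ia jb =>
    if (jb.1 : ℕ) < (ia.1 : ℕ) then (C * A ^ ((ia.1 : ℕ) - 1 - (jb.1 : ℕ)) * B) ia.2 jb.2 else 0

/-- The block row `F₂ = [C A^{n−1} B, C A^{n−2} B, …, C B]`, block `j` being `C A^{n−1−j} B`. -/
def f2Mat {n m p : ℕ} (A : Matrix (Fin n) (Fin n) ℝ) (B : Matrix (Fin n) (Fin m) ℝ)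
    (C : Matrix (Fin p) (Fin n) ℝ) :
    Matrix (Fin p) (Fin n × Fin m) ℝ :=
  Matrix.of fun a jb => (C * A ^ (n - 1 - (jb.1 : ℕ)) * B) a jb.2

theorem state_add_eq {n m : ℕ} {A : Matrix (Fin n) (Fin n) ℝ} {B : Matrix (Fin n) (Fin m) ℝ}
    {u : ℕ → Fin m → ℝ} {x : ℕ → Fin n → ℝ}
    (hx : ∀ t, x (t + 1) = A.mulVec (x t) + B.mulVec (u t)) (s k : ℕ) :
    x (s + k) = (A ^ k).mulVec (x s) +
      ∑ j ∈ Finset.range k, (A ^ (k - 1 - j) * B).mulVec (u (s + j)) := by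
  induction k with
  | zero => simp
  | succ k ih =>
    rw [← add_assoc, hx, ih, Matrix.mulVec_add, Matrix.mulVec_mulVec, ← pow_succ',
      Finset.sum_range_succ, Matrix.mulVec_sum, add_assoc]
    congr 2
    · refine Finset.sum_congr rfl fun j hj => ?_
      have hjk : k + 1 - 1 - j = k - 1 - j + 1 := by
        have := Finset.mem_range.mp hj
        omega
      rw [Matrix.mulVec_mulVec, ← Matrix.mul_assoc, ← pow_succ', hjk]
    · simp

theorem output_add_eq {n m p : ℕ} {A : Matrix (Fin n) (Fin n) ℝ} {B : Matrix (Fin n) (Fin m) ℝ}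
    {C : Matrix (Fin p) (Fin n) ℝ} {u : ℕ → Fin m → ℝ} {x : ℕ → Fin n → ℝ} {y : ℕ → Fin p → ℝ}
    (hx : ∀ t, x (t + 1) = A.mulVec (x t) + B.mulVec (u t))
    (hy : ∀ t, y t = C.mulVec (x t)) (s k : ℕ) :
    y (s + k) = (C * A ^ k).mulVec (x s) +
      ∑ j ∈ Finset.range k, (C * A ^ (k - 1 - j) * B).mulVec (u (s + j)) := by
  simp only [hy, state_add_eq hx s k, Matrix.mulVec_add, Matrix.mulVec_sum, Matrix.mulVec_mulVec,
    Matrix.mul_assoc]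

theorem f2Mat_mulVec {n m p : ℕ} (A : Matrix (Fin n) (Fin n) ℝ) (B : Matrix (Fin n) (Fin m) ℝ)
    (C : Matrix (Fin p) (Fin n) ℝ) (v : ℕ → Fin m → ℝ) :
    (f2Mat A B C).mulVec (fun jb : Fin n × Fin m => v jb.1 jb.2) =
      ∑ j ∈ Finset.range n, (C * A ^ (n - 1 - j) * B).mulVec (v j) := by
  ext a
  rw [Finset.sum_range, Finset.sum_apply]
  simp only [Matrix.mulVec, dotProduct, f2Mat, Matrix.of_apply, Fintype.sum_prod_type]

theorem f1Mat_mulVec_apply {n m p : ℕ} (A : Matrix (Fin n) (Fin n) ℝ)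
    (B : Matrix (Fin n) (Fin m) ℝ) (C : Matrix (Fin p) (Fin n) ℝ) (v : ℕ → Fin m → ℝ)
    (i : Fin n) (a : Fin p) :
    (f1Mat A B C).mulVec (fun jb : Fin n × Fin m => v jb.1 jb.2) (i, a) =
      (∑ j ∈ Finset.range i, (C * A ^ ((i : ℕ) - 1 - j) * B).mulVec (v j)) a := by
  have hr : Finset.range (i : ℕ) = (Finset.range n).filter (· < (i : ℕ)) := by
    ext j
    have := i.isLt
    simp only [Finset.mem_range, Finset.mem_filter]
    omega
  rw [hr, Finset.sum_filter, Finset.sum_range, Finset.sum_apply]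
  simp only [Matrix.mulVec, dotProduct, f1Mat, Matrix.of_apply, Fintype.sum_prod_type]
  refine Finset.sum_congr rfl fun j _ => ?_
  split_ifs <;> simp [Matrix.mulVec, dotProduct]

/-- The stacked outputs over a window of length `n` are `O x(s) + F₁ U`. -/
theorem stacked_output_eq {n m p : ℕ} {A : Matrix (Fin n) (Fin n) ℝ}
    {B : Matrix (Fin n) (Fin m) ℝ} {C : Matrix (Fin p) (Fin n) ℝ} {u : ℕ → Fin m → ℝ}
    {x : ℕ → Fin n → ℝ} {y : ℕ → Fin p → ℝ}
    (hx : ∀ t, x (t + 1) = A.mulVec (x t) + B.mulVec (u t))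
    (hy : ∀ t, y t = C.mulVec (x t)) (s : ℕ) :
    (fun ia : Fin n × Fin p => y (s + (ia.1 : ℕ)) ia.2) =
      (obsMat A C).mulVec (x s) +
        (f1Mat A B C).mulVec (fun jb : Fin n × Fin m => u (s + (jb.1 : ℕ)) jb.2) := by
  ext ⟨i, a⟩
  rw [Pi.add_apply, f1Mat_mulVec_apply A B C (fun j => u (s + j)), output_add_eq hx hy]
  rfl

/-- Behavioral representation of the output: for an observable system (`L` a left inverse
of the observability matrix), with `𝒜_y = C Aⁿ L` and `𝒜_u = F₂ − C Aⁿ L F₁`, the output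
satisfies `y(t) = 𝒜_u U(t−1) + 𝒜_y Y(t−1)` for all `t ≥ n`. -/
theorem stmt_5 (n m p : ℕ) (hn : 0 < n) (hm : 0 < m) (hp : 0 < p)
    (A : Matrix (Fin n) (Fin n) ℝ) (B : Matrix (Fin n) (Fin m) ℝ)
    (C : Matrix (Fin p) (Fin n) ℝ)
    (L : Matrix (Fin n) (Fin n × Fin p) ℝ) (hL : L * obsMat A C = 1)
    (u : ℕ → Fin m → ℝ) (x : ℕ → Fin n → ℝ) (y : ℕ → Fin p → ℝ)
    (hx : ∀ t, x (t + 1) = A.mulVec (x t) + B.mulVec (u t))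
    (hy : ∀ t, y t = C.mulVec (x t)) :
    ∀ t, n ≤ t →
      y t =
        (f2Mat A B C - C * A ^ n * L * f1Mat A B C).mulVec
          (fun jb : Fin n × Fin m => u (t - n + (jb.1 : ℕ)) jb.2) +
        (C * A ^ n * L).mulVec
          (fun ia : Fin n × Fin p => y (t - n + (ia.1 : ℕ)) ia.2) := by
  intro t ht
  have hout := output_add_eq hx hy (t - n) n
  rw [Nat.sub_add_cancel ht] at hout
  rw [stacked_output_eq hx hy, hout, ← f2Mat_mulVec A B C (fun j => u (t - n + j)),
    Matrix.mulVec_add, Matrix.mulVec_mulVec, Matrix.mulVec_mulVec, Matrix.mul_assoc _ L (obsMat A C),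
    hL, Matrix.mul_one, Matrix.sub_mulVec]
  abel
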